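/- arXiv:2304.05532 — 2 statements merged into one kernel-verified Lean document; each statement's English description precedes it below -/
import Mathlib

section
/- (Corollary 4.3) Let N ≥ 3 and let φ : Q_N × Q_N → Q_N × Q_N be given by φ(a,b) = (b, a*b). Let k ≥ 0 and write k = s + m(N−1) with integers s,m and 0 ≤ s ≤ N−2. Then: (a) the first coordinate of φ^{2k}(N,1) equals N for every k; (b) the second coordinate of φ^{2k}(N,1) equals s+1; (c) the first coordinate of φ^{2k+1}(N,1) equals s+1; (d) the second coordinate of φ^{2k+1}(N,1) equals N for every k. -/
/-- The binary operation of the quandle `Q_N = {1,…,N}` from Example 3.1: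
`x*y = x` if `y ≠ N`; `x*N = x+1` if `x ≠ N-1, x ≠ N`; `(N-1)*N = 1`; `N*N = N`. -/
def qop (N x y : ℕ) : ℕ :=
  if y ≠ N then x
  else if x = N then N
  else if x = N - 1 then 1
  else x + 1

/-- The right-inverse operation `x \bar* y` of the quandle `Q_N`:
`x \bar* y = x` if `y ≠ N`; `x \bar* N = x-1` if `x ≠ 1, x ≠ N`; `1 \bar* N = N-1`; `N \bar* N = N`. -/
def qinv (N x y : ℕ) : ℕ :=
  if y ≠ N then x
  else if x = N then N
  else if x = 1 then N - 1
  else x - 1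

/-- The effect of `σ_i^{-1}` on the pair of entries `(a,b)`: `φ(a,b) = (b, a*b)`. -/
def phi (N : ℕ) (p : ℕ × ℕ) : ℕ × ℕ := (p.2, qop N p.1 p.2)

/-- The effect of `σ_i` on the pair of entries `(a,b)`: `ψ(a,b) = (b \bar* a, a)`. -/
def psi (N : ℕ) (p : ℕ × ℕ) : ℕ × ℕ := (qinv N p.2 p.1, p.1)

lemma phi_fixed_left {N a : ℕ} (ha : a ≠ N) : phi N (N, a) = (a, N) := by
  simp [phi, qop, ha]

lemma qop_right_eq_succ_mod {N a : ℕ} (ha : a < N - 1) :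
    qop N (a + 1) N = (a + 1) % (N - 1) + 1 := by
  have hne : a + 1 ≠ N := by omega
  by_cases h : a + 1 = N - 1
  · simp [qop, h, show N - 1 ≠ N by omega]
  · rw [Nat.mod_eq_of_lt (by omega)]
    simp [qop, hne, h]

lemma phi_iterate_two_mul {N : ℕ} (hN : 2 ≤ N) (k : ℕ) :
    (phi N)^[2 * k] (N, 1) = (N, k % (N - 1) + 1) := by
  induction k with
  | zero => simp
  | succ k ih =>
    have hlt : k % (N - 1) < N - 1 := Nat.mod_lt _ (by omega)
    rw [show 2 * (k + 1) = 2 * k + 1 + 1 by ring, Function.iterate_succ_apply',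
      Function.iterate_succ_apply', ih, phi_fixed_left (by omega)]
    simp [phi, qop_right_eq_succ_mod hlt]

/-- Corollary 4.3: values of the iterates of `φ(a,b) = (b, a*b)` starting at `(N, 1)`,
for arbitrary `k = s + m(N-1)` with `0 ≤ s ≤ N-2`. -/
theorem corollary_4_3 (N k s m : ℕ) (hN : 3 ≤ N) (hk : k = s + m * (N - 1))
    (hs : s ≤ N - 2) :
    ((phi N)^[2 * k] (N, 1)).1 = N ∧
    ((phi N)^[2 * k] (N, 1)).2 = s + 1 ∧
    ((phi N)^[2 * k + 1] (N, 1)).1 = s + 1 ∧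
    ((phi N)^[2 * k + 1] (N, 1)).2 = N := by
  have hmod : k % (N - 1) = s := by
    rw [hk, Nat.add_mul_mod_self_right, Nat.mod_eq_of_lt (by omega)]
  have heven := phi_iterate_two_mul (show 2 ≤ N by omega) k
  rw [Function.iterate_succ_apply', heven, hmod, phi_fixed_left (by omega)]
  exact ⟨rfl, rfl, rfl, rfl⟩
end

section
/- (Computational content of Lemma 8.3) Let N ≥ 3 and k ≥ 0, and consider the braid-generator maps on Q_N^4. Let a = (N,N,1,1) and let c = β_3(β_2(β_2(a))) (the action of the word σ_3σ_2^2 on a). Then: (a) the tuple (β_2⁻)^2(c) (the word σ_2^{-2}σ_3σ_2^2) has equal 1st and 2nd coordinates; (b) if k ≡ 2N−5 (mod 2(N−1)), then the tuple (β_2⁻)^{k+1}(c) (the word σ_2^{-(k+1)}σ_3σ_2^2) has equal 3rd and 4th coordinates; (c) if k ≢ 2N−5 (mod 2(N−1)), then the tuple (β_2⁻)^{k+1}(c) has distinct 3rd and 4th coordinates. -/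
/-- Coloring tuples in `Q_N^4`. -/
abbrev Quad := ℕ × ℕ × ℕ × ℕ

/-- Action of the braid generator `σ_1` on `Q_N^4`: replaces `(a₁,a₂)` by `(a₂ \bar* a₁, a₁)`. -/
def b1 (N : ℕ) (a : Quad) : Quad := (qinv N a.2.1 a.1, a.1, a.2.2.1, a.2.2.2)

/-- Action of `σ_1^{-1}` on `Q_N^4`: replaces `(a₁,a₂)` by `(a₂, a₁ * a₂)`. -/
def b1inv (N : ℕ) (a : Quad) : Quad := (a.2.1, qop N a.1 a.2.1, a.2.2.1, a.2.2.2)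

/-- Action of `σ_2` on `Q_N^4`: replaces `(a₂,a₃)` by `(a₃ \bar* a₂, a₂)`. -/
def b2 (N : ℕ) (a : Quad) : Quad := (a.1, qinv N a.2.2.1 a.2.1, a.2.1, a.2.2.2)

/-- Action of `σ_2^{-1}` on `Q_N^4`: replaces `(a₂,a₃)` by `(a₃, a₂ * a₃)`. -/
def b2inv (N : ℕ) (a : Quad) : Quad := (a.1, a.2.2.1, qop N a.2.1 a.2.2.1, a.2.2.2)

/-- Action of `σ_3` on `Q_N^4`: replaces `(a₃,a₄)` by `(a₄ \bar* a₃, a₃)`. -/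
def b3 (N : ℕ) (a : Quad) : Quad := (a.1, a.2.1, qinv N a.2.2.2 a.2.2.1, a.2.2.1)

/-- Action of `σ_3^{-1}` on `Q_N^4`: replaces `(a₃,a₄)` by `(a₄, a₃ * a₄)`. -/
def b3inv (N : ℕ) (a : Quad) : Quad := (a.1, a.2.1, a.2.2.2, qop N a.2.2.1 a.2.2.2)

theorem succ_mod_eq_ite (m : ℕ) {M : ℕ} (hM : 0 < M) :
    (m + 1) % M = if m % M + 1 = M then 0 else m % M + 1 := by
  have hlt := Nat.mod_lt m hM
  rw [← Nat.mod_add_mod]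
  split_ifs with h
  · rw [h, Nat.mod_self]
  · exact Nat.mod_eq_of_lt (by omega)

theorem b3_b2_b2_apply {N : ℕ} (hN : 3 ≤ N) :
    b3 N (b2 N (b2 N (N, N, 1, 1))) = (N, N, 1, N - 1) := by
  have h1 : 1 ≠ N := by omega
  have h2 : N - 1 ≠ N := by omega
  simp [b2, b3, qinv, h1, h2]

/-- Right multiplication by `N` permutes `1, …, N - 1` cyclically. -/
theorem qop_mod_succ {N : ℕ} (hN : 3 ≤ N) (m : ℕ) :
    qop N (m % (N - 1) + 1) N = (m + 1) % (N - 1) + 1 := by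
  have hlt := Nat.mod_lt m (show 0 < N - 1 by omega)
  rw [succ_mod_eq_ite m (by omega), qop]
  split_ifs <;> omega

theorem b2inv_apply_of_ne {N x : ℕ} (hx : x ≠ N) (y z : ℕ) :
    b2inv N (N, y, x, z) = (N, x, y, z) := by
  simp [b2inv, qop, hx]

theorem b2inv_iterate_even {N : ℕ} (hN : 3 ≤ N) (m : ℕ) :
    (b2inv N)^[2 * m] (N, N, 1, N - 1) = (N, N, m % (N - 1) + 1, N - 1) := by
  induction m with
  | zero => simp
  | succ m ih =>
    have hlt := Nat.mod_lt m (show 0 < N - 1 by omega)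
    rw [show 2 * (m + 1) = 2 * m + 1 + 1 by ring, Function.iterate_succ_apply',
      Function.iterate_succ_apply', ih, b2inv_apply_of_ne (by omega), ← qop_mod_succ hN]
    rfl

theorem b2inv_iterate_odd {N : ℕ} (hN : 3 ≤ N) (m : ℕ) :
    (b2inv N)^[2 * m + 1] (N, N, 1, N - 1) = (N, m % (N - 1) + 1, N, N - 1) := by
  have hlt := Nat.mod_lt m (show 0 < N - 1 by omega)
  rw [Function.iterate_succ_apply', b2inv_iterate_even hN, b2inv_apply_of_ne (by omega)]

theorem b2inv_iterate_third_eq_fourth_iff {N : ℕ} (hN : 3 ≤ N) (k : ℕ) :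
    ((b2inv N)^[k + 1] (N, N, 1, N - 1)).2.2.1 = ((b2inv N)^[k + 1] (N, N, 1, N - 1)).2.2.2 ↔
      k % (2 * (N - 1)) = 2 * N - 5 := by
  rw [Nat.mod_mul]
  have hlt := Nat.mod_lt (k / 2) (show 0 < N - 1 by omega)
  obtain hk | hk := Nat.mod_two_eq_zero_or_one k
  · rw [show k + 1 = 2 * (k / 2) + 1 by omega, b2inv_iterate_odd hN]
    dsimp only
    omega
  · rw [show k + 1 = 2 * (k / 2 + 1) by omega, b2inv_iterate_even hN,
      succ_mod_eq_ite _ (by omega)]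
    dsimp only
    split_ifs <;> omega

/-- Computational content of Lemma 8.3: with `a = (N,N,1,1)` and
`c = β_3(β_2(β_2(a)))` (the word `σ_3σ_2²`):
(a) `σ_2^{-2}σ_3σ_2²` gives equal 1st and 2nd coordinates;
(b) if `k ≡ 2N-5 (mod 2(N-1))`, then `σ_2^{-(k+1)}σ_3σ_2²` gives equal 3rd and 4th coordinates;
(c) otherwise they are distinct. -/
theorem lemma_8_3 (N k : ℕ) (hN : 3 ≤ N) :
    ((b2inv N)^[2] (b3 N (b2 N (b2 N (N, N, 1, 1))))).1 =
      ((b2inv N)^[2] (b3 N (b2 N (b2 N (N, N, 1, 1))))).2.1 ∧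
    (k % (2 * (N - 1)) = 2 * N - 5 →
      ((b2inv N)^[k + 1] (b3 N (b2 N (b2 N (N, N, 1, 1))))).2.2.1 =
        ((b2inv N)^[k + 1] (b3 N (b2 N (b2 N (N, N, 1, 1))))).2.2.2) ∧
    (k % (2 * (N - 1)) ≠ 2 * N - 5 →
      ((b2inv N)^[k + 1] (b3 N (b2 N (b2 N (N, N, 1, 1))))).2.2.1 ≠
        ((b2inv N)^[k + 1] (b3 N (b2 N (b2 N (N, N, 1, 1))))).2.2.2) := by
  rw [b3_b2_b2_apply hN]
  refine ⟨?_, (b2inv_iterate_third_eq_fourth_iff hN k).2,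
    mt (b2inv_iterate_third_eq_fourth_iff hN k).1⟩
  rw [show 2 = 2 * 1 by rfl, b2inv_iterate_even hN]
end
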